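/- arXiv:2505.01669 — 2 statements merged into one kernel-verified Lean document; each statement's English description precedes it below -/
import Mathlib

section
/- For every b > 0 there exists a constant C = C(b) > 0 such that the following holds for all integers p ≥ 2: if Y = (Y₁, …, Y_p) is a centered Gaussian random vector in ℝᵖ with E(Y_j²) ≥ b for all j = 1, …, p, then for every y ∈ ℝᵖ and every a > 0, P(Y_j ≤ y_j + a for all j) − P(Y_j ≤ y_j for all j) ≤ C · a · (log p)^{1/2}. -/
open MeasureTheory ProbabilityTheory

lemma nz_pdf (p : ℕ) (hp : 2 ≤ p) (m x : ℝ) (G : ℝ → ENNReal) (hG : Monotone G) (hG1 : ∀ t, G t ≤ 1)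
    (T : ℝ) (hT : T = Real.sqrt (2 * Real.log p)) (hT1 : 1 ≤ T) :
    gaussianPDF m 1 x * G x ≤ ENNReal.ofReal (1 / p) + ENNReal.ofReal (5 * T) *
      ∫⁻ u in Set.Icc x (x + 1 / T), gaussianPDF m 1 u * G u := by
  have hT0 : 0 < T := by linarith
  have hp0 : (0:ℝ) < p := by positivity
  have hlog : 0 ≤ Real.log p := Real.log_nonneg (by exact_mod_cast (by omega : 1 ≤ p))
  have hTsq : T ^ 2 = 2 * Real.log p := by rw [hT, Real.sq_sqrt (by positivity)]
  have hpi : 0 < (√(2 * Real.pi))⁻¹ := by positivity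
  by_cases h : |x - m| ≤ T
  · refine le_trans ?_ le_add_self
    have key : ∀ u ∈ Set.Icc x (x + 1 / T),
        ENNReal.ofReal (1/5) * (gaussianPDF m 1 x * G x) ≤ gaussianPDF m 1 u * G u := by
      intro u hu
      rw [← mul_assoc]
      refine mul_le_mul' ?_ (hG hu.1)
      rw [gaussianPDF, gaussianPDF, ← ENNReal.ofReal_mul (by norm_num)]
      apply ENNReal.ofReal_le_ofReal
      simp only [gaussianPDFReal, NNReal.coe_one, mul_one]
      have h1 : Real.exp (-(3/2)) * Real.exp (-(x - m) ^ 2 / 2) ≤ Real.exp (-(u - m) ^ 2 / 2) := by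
        rw [← Real.exp_add]
        apply Real.exp_le_exp.2
        have hd0 : 0 ≤ u - x := by linarith [hu.1]
        have hd : (u - x) * T ≤ 1 := by
          have := hu.2
          have : u - x ≤ 1 / T := by linarith
          rwa [le_div_iff₀ hT0] at this
        have hd1 : u - x ≤ 1 := by nlinarith
        have := (abs_le.1 h).2
        have : (u - x) * (x - m) ≤ 1 := by nlinarith
        nlinarith
      have h2 : (1/5 : ℝ) ≤ Real.exp (-(3/2)) := by
        rw [Real.exp_neg, one_div]
        apply inv_anti₀ (Real.exp_pos _)
        have h3 : Real.exp (3/2) ^ 2 = Real.exp 1 ^ 3 := by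
          rw [← Real.exp_nat_mul, ← Real.exp_nat_mul]; norm_num
        have h4 := Real.exp_one_lt_d9
        have h5 : Real.exp 1 ^ 3 ≤ 2.72 ^ 3 := by
          apply pow_le_pow_left₀ (Real.exp_pos _).le; linarith
        apply le_of_sq_le_sq _ (by norm_num)
        rw [h3]; refine h5.trans (by norm_num)
      calc _ = (√(2 * Real.pi))⁻¹ * ((1/5) * Real.exp (-(x - m) ^ 2 / 2)) := by ring
        _ ≤ (√(2 * Real.pi))⁻¹ * (Real.exp (-(3/2)) * Real.exp (-(x - m) ^ 2 / 2)) := by gcongr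
        _ ≤ _ := by gcongr
    have h6 := setLIntegral_mono_ae' (μ := volume) (s := Set.Icc x (x + 1 / T)) measurableSet_Icc
      (Filter.Eventually.of_forall key)
    rw [setLIntegral_const, Real.volume_Icc] at h6
    refine le_trans (le_of_eq ?_) (mul_le_mul_right h6 (ENNReal.ofReal (5 * T)))
    rw [show x + 1 / T - x = 1 / T by ring]
    have : ENNReal.ofReal (5 * T) * ENNReal.ofReal (1/5) * ENNReal.ofReal (1/T) = 1 := by
      rw [← ENNReal.ofReal_mul (by positivity), ← ENNReal.ofReal_mul (by positivity)]
      rw [show 5 * T * (1/5) * (1/T) = 1 by field_simp]; simp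
    calc _ = 1 * (gaussianPDF m 1 x * G x) := by simp
      _ = _ := by rw [← this]; ring
  · refine le_trans ?_ le_self_add
    refine (mul_le_of_le_one_right' (hG1 x)).trans ?_
    rw [gaussianPDF]
    apply ENNReal.ofReal_le_ofReal
    simp only [gaussianPDFReal, NNReal.coe_one, mul_one]
    have h1 : Real.exp (-(x - m) ^ 2 / 2) ≤ 1 / p := by
      rw [one_div, ← Real.exp_log hp0, ← Real.exp_neg]
      apply Real.exp_le_exp.2
      have : T ^ 2 ≤ (x - m) ^ 2 := by
        rw [← sq_abs (x - m)]
        push Not at h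
        gcongr
      linarith
    have h2 : (√(2 * Real.pi))⁻¹ ≤ 1 := by
      apply inv_le_one_of_one_le₀
      rw [Real.one_le_sqrt]
      linarith [Real.pi_gt_three]
    calc _ ≤ 1 * (1 / (p:ℝ)) := by gcongr
      _ = _ := by simp

lemma nz_cond {p : ℕ} (μ : Measure (Fin p → ℝ)) [IsGaussian μ] (m : Fin p → ℝ)
    (hm : ∀ j, μ.map (fun x => x j) = gaussianReal (m j) 1) (j : Fin p) :
    ∃ G : ℝ → ENNReal, Monotone G ∧ (∀ t, G t ≤ 1) ∧ ∀ S : Set ℝ, MeasurableSet S →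
      μ {x | x j ∈ S ∧ ∀ i, x i ≤ x j ∧ (i < j → x i < x j)} =
        ∫⁻ t in S, gaussianPDF (m j) 1 t * G t := by
  have hgl : HasGaussianLaw (id : (Fin p → ℝ) → _) μ := IsGaussian.hasGaussianLaw_id
  have hL2 : ∀ i, MemLp (fun x : Fin p → ℝ => x i) 2 μ := fun i =>
    IsGaussian.memLp_dual μ (.proj i) 2 (by simp)
  have hvar : ∀ i, Var[fun x : Fin p → ℝ => x i; μ] = 1 := by
    intro i
    have := variance_fun_id_gaussianReal (μ := m i) (v := 1)
    rw [← hm i, variance_map (X := fun x : ℝ => x) (Y := fun x : Fin p → ℝ => x i) measurable_id.aemeasurable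
      (measurable_pi_apply i).aemeasurable] at this
    simpa [Function.comp_def] using this
  set ρ : Fin p → ℝ := fun i => cov[fun x : Fin p → ℝ => x i, fun x => x j; μ] with hρ
  have hρ1 : ∀ i, ρ i ≤ 1 := by
    intro i
    have h := variance_nonneg (fun x : Fin p → ℝ => x i - x j) μ
    have h' := variance_fun_sub (hL2 i) (hL2 j)
    rw [h', hvar, hvar] at h
    simp only [hρ]; linarith
  let V : (Fin p → ℝ) → (Fin p → ℝ) := fun x i => x i - ρ i * x j
  have hV : Measurable V := by fun_prop
  have hind : IndepFun (fun x : Fin p → ℝ => fun _ : Unit => x j) V μ := by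
    refine HasGaussianLaw.indepFun_of_covariance_eval (X := fun _ (x : Fin p → ℝ) => x j)
      (Y := fun i (x : Fin p → ℝ) => x i - ρ i * x j) ?_ ?_
    · let Lc : (Fin p → ℝ) →L[ℝ] ((Unit → ℝ) × (Fin p → ℝ)) :=
        ContinuousLinearMap.prod (.pi fun _ => .proj j) (.pi fun i => .proj i - ρ i • .proj j)
      exact hgl.map Lc
    · intro _ i
      rw [covariance_fun_sub_right (hL2 j) (hL2 i) ((hL2 j).const_mul _),
        covariance_const_mul_right, covariance_self (measurable_pi_apply j).aemeasurable, hvar, covariance_comm]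
      simp [hρ]
  have hind' : IndepFun (fun x : Fin p → ℝ => x j) V μ :=
    hind.comp (φ := fun f : Unit → ℝ => f ()) (ψ := id) (by fun_prop) measurable_id
  have hprod := (indepFun_iff_map_prod_eq_prod_map_map (measurable_pi_apply j).aemeasurable
    hV.aemeasurable).1 hind'
  have : IsProbabilityMeasure (μ.map V) := Measure.isProbabilityMeasure_map hV.aemeasurable
  let G : ℝ → ENNReal := fun t =>
    (μ.map V) {v | ∀ i, v i ≤ (1 - ρ i) * t ∧ (i < j → v i < (1 - ρ i) * t)}
  have hGm : Monotone G := by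
    intro s t hst
    refine measure_mono fun v hv i => ?_
    have h1 : (1 - ρ i) * s ≤ (1 - ρ i) * t :=
      mul_le_mul_of_nonneg_left hst (by linarith [hρ1 i])
    exact ⟨(hv i).1.trans h1, fun h => ((hv i).2 h).trans_le h1⟩
  refine ⟨G, hGm, fun t => prob_le_one, fun S hS => ?_⟩
  set E : Set (ℝ × (Fin p → ℝ)) :=
    {q | q.1 ∈ S ∧ ∀ i, q.2 i ≤ (1 - ρ i) * q.1 ∧ (i < j → q.2 i < (1 - ρ i) * q.1)} with hE
  have hEm : MeasurableSet E := by
    have : E = (Prod.fst ⁻¹' S) ∩ ⋂ i, ({q : ℝ × (Fin p → ℝ) | q.2 i ≤ (1 - ρ i) * q.1} ∩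
        {q : ℝ × (Fin p → ℝ) | i < j → q.2 i < (1 - ρ i) * q.1}) := by
      ext q; simp [hE]
    rw [this]
    refine (measurable_fst hS).inter (MeasurableSet.iInter fun i => ?_)
    refine (measurableSet_le (by fun_prop) (by fun_prop)).inter ?_
    by_cases h : i < j
    · simp only [h, true_imp_iff]
      exact measurableSet_lt (by fun_prop) (by fun_prop)
    · simp [h]
  have h1 : {x : Fin p → ℝ | x j ∈ S ∧ ∀ i, x i ≤ x j ∧ (i < j → x i < x j)} =
      (fun x => (x j, V x)) ⁻¹' E := by
    ext x
    simp only [hE, V, Set.mem_ofPred_eq, Set.mem_preimage]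
    have e1 : ∀ i, (x i - ρ i * x j ≤ (1 - ρ i) * x j) ↔ x i ≤ x j := fun i => by
      constructor <;> intro h <;> linarith
    have e2 : ∀ i, (x i - ρ i * x j < (1 - ρ i) * x j) ↔ x i < x j := fun i => by
      constructor <;> intro h <;> linarith
    simp only [e1, e2]
  rw [h1, ← Measure.map_apply (by fun_prop) hEm, hprod, Measure.prod_apply hEm, hm,
    gaussianReal_of_var_ne_zero _ one_ne_zero, ← lintegral_indicator hS]
  have h2 : ∀ t, (μ.map V) (Prod.mk t ⁻¹' E) = S.indicator G t := by
    intro t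
    by_cases ht : t ∈ S
    · simp [hE, ht, G, Set.preimage]
    · simp [hE, ht, Set.preimage]
  simp_rw [h2]
  rw [lintegral_withDensity_eq_lintegral_mul _ (measurable_gaussianPDF _ _)
    (hGm.measurable.indicator hS)]
  refine lintegral_congr fun t => ?_
  by_cases ht : t ∈ S <;> simp [ht]

lemma nz_core {p : ℕ} (hp : 2 ≤ p) (μ : Measure (Fin p → ℝ)) [IsGaussian μ] (m : Fin p → ℝ)
    (hm : ∀ j, μ.map (fun x => x j) = gaussianReal (m j) 1) (a : ℝ) (ha : 0 < a) :
    μ {x | (∃ j, 0 < x j) ∧ ∀ j, x j ≤ a} ≤ ENNReal.ofReal (9 * a * √(Real.log p)) := by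
  have : Nonempty (Fin p) := ⟨⟨0, by omega⟩⟩
  choose G hGm hG1 hG using nz_cond μ m hm
  have hp2 : (2:ℝ) ≤ p := by exact_mod_cast hp
  have hlog : Real.log 2 ≤ Real.log p := Real.log_le_log (by norm_num) hp2
  have hlog2 := Real.log_two_gt_d9
  set T := √(2 * Real.log p) with hT
  have hT1 : 1 ≤ T := by rw [hT, Real.one_le_sqrt]; linarith
  have hT0 : 0 < T := by linarith
  let A : Fin p → Set (Fin p → ℝ) := fun j => {x | ∀ i, x i ≤ x j ∧ (i < j → x i < x j)}
  have hAm : ∀ j, MeasurableSet (A j) := by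
    intro j
    have : A j = ⋂ i, ({x | x i ≤ x j} ∩ {x | i < j → x i < x j}) := by
      ext q; simp [A]
    rw [this]
    refine MeasurableSet.iInter fun i => ?_
    refine (measurableSet_le (by fun_prop) (by fun_prop)).inter ?_
    by_cases h : i < j
    · simp only [h, true_imp_iff]
      exact measurableSet_lt (by fun_prop) (by fun_prop)
    · simp [h]
  have hAd : Pairwise (Function.onFun Disjoint A) := by
    intro i j hij
    refine Set.disjoint_left.2 fun x hi hj => ?_
    rcases lt_or_gt_of_ne hij with h | h
    · exact absurd ((hj i).2 h) (not_lt.2 (hi j).1)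
    · exact absurd ((hi j).2 h) (not_lt.2 (hj i).1)
  have hAc : ∀ x : Fin p → ℝ, ∃ j, x ∈ A j := by
    intro x
    obtain ⟨k, hk⟩ := Finite.exists_max x
    let s : Finset (Fin p) := Finset.univ.filter fun j => x k ≤ x j
    have hs : s.Nonempty := ⟨k, by simp [s]⟩
    refine ⟨s.min' hs, fun i => ?_⟩
    have hmin := s.min'_mem hs
    have h1 : x k ≤ x (s.min' hs) := by simpa [s] using hmin
    refine ⟨(hk i).trans h1, fun hi => ?_⟩
    by_contra hcon
    push Not at hcon
    have : i ∈ s := by simp [s]; exact h1.trans hcon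
    exact absurd (s.min'_le i this) (not_le.2 hi)
  have hpt : ∀ x, ∑ j, gaussianPDF (m j) 1 x * G j x ≤ ENNReal.ofReal (1 + 5 * T) := by
    intro x
    have hsum : ∑ j, ∫⁻ u in Set.Icc x (x + 1 / T), gaussianPDF (m j) 1 u * G j u ≤ 1 := by
      have : ∀ j, ∫⁻ u in Set.Icc x (x + 1 / T), gaussianPDF (m j) 1 u * G j u ≤ μ (A j) := by
        intro j
        rw [← hG j _ measurableSet_Icc]
        exact measure_mono fun x hx => hx.2
      refine (Finset.sum_le_sum fun j _ => this j).trans ?_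
      rw [← tsum_fintype (L := .unconditional _), ← measure_iUnion hAd hAm]
      exact prob_le_one
    calc _ ≤ ∑ j : Fin p, (ENNReal.ofReal (1 / p) + ENNReal.ofReal (5 * T) *
            ∫⁻ u in Set.Icc x (x + 1 / T), gaussianPDF (m j) 1 u * G j u) :=
          Finset.sum_le_sum fun j _ => nz_pdf p hp (m j) x (G j) (hGm j) (hG1 j) T hT hT1
      _ = p * ENNReal.ofReal (1 / p) + ENNReal.ofReal (5 * T) * ∑ j : Fin p,
            ∫⁻ u in Set.Icc x (x + 1 / T), gaussianPDF (m j) 1 u * G j u := by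
          rw [Finset.sum_add_distrib, Finset.mul_sum]; simp
      _ ≤ 1 + ENNReal.ofReal (5 * T) * 1 := by
          gcongr
          rw [← ENNReal.ofReal_natCast, ← ENNReal.ofReal_mul (by positivity)]
          rw [mul_one_div_cancel (by positivity)]; simp
      _ = _ := by
          rw [ENNReal.ofReal_add (by norm_num) (by positivity)]; simp
  calc μ {x | (∃ j, 0 < x j) ∧ ∀ j, x j ≤ a}
      ≤ μ (⋃ j, {x | x j ∈ Set.Ioc 0 a ∧ ∀ i, x i ≤ x j ∧ (i < j → x i < x j)}) := by
        refine measure_mono fun x hx => ?_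
        obtain ⟨⟨k, hk⟩, hx2⟩ := hx
        obtain ⟨j, hj⟩ := hAc x
        exact Set.mem_iUnion.2 ⟨j, ⟨hk.trans_le (hj k).1, hx2 j⟩, hj⟩
    _ ≤ ∑ j, μ {x | x j ∈ Set.Ioc 0 a ∧ ∀ i, x i ≤ x j ∧ (i < j → x i < x j)} :=
        measure_iUnion_fintype_le _ _
    _ = ∫⁻ t in Set.Ioc 0 a, ∑ j, gaussianPDF (m j) 1 t * G j t := by
        rw [lintegral_finsetSum]
        · exact Finset.sum_congr rfl fun j _ => hG j _ measurableSet_Ioc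
        · intro j _
          exact (measurable_gaussianPDF _ _).mul (hGm j).measurable
    _ ≤ ∫⁻ t in Set.Ioc 0 a, ENNReal.ofReal (1 + 5 * T) := lintegral_mono hpt
    _ = ENNReal.ofReal ((1 + 5 * T) * a) := by
        rw [setLIntegral_const, Real.volume_Ioc, sub_zero, ENNReal.ofReal_mul (by positivity)]
    _ ≤ _ := by
        apply ENNReal.ofReal_le_ofReal
        have : T ≤ 1.5 * √(Real.log p) := by
          rw [hT, Real.sqrt_mul (by norm_num)]
          gcongr
          rw [Real.sqrt_le_left (by norm_num)]; norm_num
        nlinarith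

theorem nazarov_inequality (b : ℝ) (hb : 0 < b) :
    ∃ C : ℝ, 0 < C ∧
      ∀ (p : ℕ), 2 ≤ p →
      ∀ (μ : Measure (Fin p → ℝ)), IsProbabilityMeasure μ →
      (∀ c : Fin p → ℝ, ∃ v : NNReal,
        μ.map (fun x => ∑ j, c j * x j) = gaussianReal 0 v) →
      (∀ j : Fin p, b ≤ ∫ x, (x j) ^ 2 ∂μ) →
      ∀ (y : Fin p → ℝ) (a : ℝ), 0 < a →
        (μ {x | ∀ j, x j ≤ y j + a}).toReal - (μ {x | ∀ j, x j ≤ y j}).toReal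
          ≤ C * a * Real.sqrt (Real.log p) := by
  refine ⟨9 / √b, by positivity, fun p hp μ _ hg hvar y a ha => ?_⟩
  have hsb : 0 < √b := Real.sqrt_pos.2 hb
  have hgauss : IsGaussian μ := by
    refine isGaussian_of_map_eq_gaussianReal fun L => ?_
    obtain ⟨v, hv⟩ := hg (fun j => L (Pi.single j 1))
    refine ⟨0, v, ?_⟩
    rw [← hv]
    congr 1
    ext x
    conv_lhs => rw [← LinearMap.sum_single_apply (fun _ => ℝ) x]
    rw [map_sum]
    refine Finset.sum_congr rfl fun j _ => ?_
    rw [mul_comm, ← smul_eq_mul, ← map_smul, ← Pi.single_smul]; simp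
  have hlaw : ∀ j, ∃ v : NNReal, μ.map (fun x => x j) = gaussianReal 0 v := by
    intro j
    obtain ⟨v, hv⟩ := hg (Pi.single j 1)
    refine ⟨v, ?_⟩
    rw [← hv]; simp [Pi.single_apply]
  choose v hv using hlaw
  have hvb : ∀ j, b ≤ v j := by
    intro j
    refine (hvar j).trans (le_of_eq ?_)
    have h := variance_fun_id_gaussianReal (μ := 0) (v := v j)
    rw [variance_of_integral_eq_zero (by fun_prop) (by simp)] at h
    rw [← h, ← hv j, integral_map (measurable_pi_apply j).aemeasurable (by fun_prop)]
  have hvpos : ∀ j, (0:ℝ) < v j := fun j => hb.trans_le (hvb j)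
  let σ : Fin p → ℝ := fun j => √(v j)
  have hσ : ∀ j, √b ≤ σ j := fun j => Real.sqrt_le_sqrt (hvb j)
  have hσ0 : ∀ j, 0 < σ j := fun j => hsb.trans_le (hσ j)
  have hσsq : ∀ j, σ j ^ 2 = v j := fun j => Real.sq_sqrt (hvpos j).le
  let F : (Fin p → ℝ) → (Fin p → ℝ) := fun x j => (x j - y j) / σ j
  have hF : Measurable F := by fun_prop
  have hFg : IsGaussian (μ.map F) := by
    let Lc : (Fin p → ℝ) →L[ℝ] (Fin p → ℝ) := .pi fun j => (σ j)⁻¹ • .proj j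
    have h : μ.map F = (μ.map Lc).map (fun x => x + fun j => - y j / σ j) := by
      rw [Measure.map_map (by fun_prop) (by fun_prop)]
      congr 1
      ext x j
      simp [F, Lc]; ring
    rw [h]; infer_instance
  have hFl : ∀ j, (μ.map F).map (fun x => x j) = gaussianReal (- y j / σ j) 1 := by
    intro j
    rw [Measure.map_map (by fun_prop) hF]
    have h : (fun x : Fin p → ℝ => x j) ∘ F = (fun t => t / σ j) ∘ (fun t => t - y j) ∘
      (fun x => x j) := by ext x; simp [F]
    rw [h, ← Measure.map_map (by fun_prop) (by fun_prop),
      ← Measure.map_map (by fun_prop) (by fun_prop), hv, gaussianReal_map_sub_const,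
      gaussianReal_map_div_const]
    congr 1
    · simp
    · ext
      simp [hσsq, (hvpos j).ne']
  have hcore := nz_core hp (μ.map F) (fun j => - y j / σ j) hFl (a / √b) (by positivity)
  have hBm : MeasurableSet {x : Fin p → ℝ | ∀ j, x j ≤ y j} := by
    rw [Set.ofPred_forall]
    exact MeasurableSet.iInter fun j => measurableSet_le (by fun_prop) (by fun_prop)
  have hsub : {x : Fin p → ℝ | ∀ j, x j ≤ y j} ⊆ {x | ∀ j, x j ≤ y j + a} :=
    fun x hx j => (hx j).trans (by linarith)
  change μ.real _ - μ.real _ ≤ _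
  rw [← measureReal_sdiff hsub hBm]
  refine ENNReal.toReal_le_of_le_ofReal (by positivity) ?_
  rw [show 9 / √b * a * √(Real.log p) = 9 * (a / √b) * √(Real.log p) by ring]
  refine le_trans ?_ hcore
  refine le_trans ?_ (Measure.le_map_apply hF.aemeasurable _)
  refine measure_mono fun x hx => ?_
  obtain ⟨h1, h2⟩ := hx
  simp only [Set.mem_ofPred_eq, not_forall, not_le] at h1 h2
  obtain ⟨k, hk⟩ := h2
  refine ⟨⟨k, div_pos (by linarith) (hσ0 k)⟩, fun j => ?_⟩
  simp only [F]
  calc _ ≤ a / σ j := by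
        apply div_le_div_of_nonneg_right _ (hσ0 j).le; linarith [h1 j]
    _ ≤ _ := div_le_div_of_nonneg_left ha.le hsb (hσ j)
end

section
/- For each p, let Z = (Z₁, …, Z_p) be a standard Gaussian random vector in ℝᵖ (i.i.d. N(0,1) coordinates). Define M_p = max_{1 ≤ i ≤ p} Zᵢ² − 2 log p + log log p and S_p = (‖Z‖² − p)/√(2p). Then for all x, y ∈ ℝ, P(M_p ≤ x, S_p ≤ y) → F(x)·Φ(y) as p → ∞, where F(x) = exp(−π^{−1/2} e^{−x/2}) and Φ is the standard normal cumulative distribution function. In particular, M_p and S_p are asymptotically independent. -/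
open MeasureTheory ProbabilityTheory Filter
open scoped Topology

lemma gm_two : ∫ z, z ^ 2 ∂(gaussianReal 0 1) = 1 := by
  have h := variance_fun_id_gaussianReal (μ := 0) (v := 1)
  rw [variance_eq_integral measurable_id'.aemeasurable] at h
  simpa using h

lemma gm_four : ∫ z, z ^ 4 ∂(gaussianReal 0 1) = 3 := by
  have h0 : ∫ z, z ^ 4 ∂(gaussianReal 0 1) =
      iteratedDeriv 4 (mgf (fun x ↦ x) (gaussianReal 0 1)) 0 := by
    rw [iteratedDeriv_mgf_zero] <;> simp
  rw [h0, mgf_fun_id_gaussianReal]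
  have hE : ∀ t : ℝ, HasDerivAt (fun t : ℝ ↦ Real.exp (0 * t + ((1 : NNReal) : ℝ) * t ^ 2 / 2))
      (t * Real.exp (t ^ 2 / 2)) t := by
    intro t
    have : HasDerivAt (fun t : ℝ ↦ t ^ 2 / 2) t t := by
      have := (hasDerivAt_pow 2 t).div_const 2
      convert! this using 1; simp
    convert! this.exp using 1
    · ext; simp
    · ring
  have hE' : ∀ t : ℝ, HasDerivAt (fun t : ℝ ↦ Real.exp (t ^ 2 / 2)) (t * Real.exp (t ^ 2 / 2)) t := by
    intro t; have := hE t; simpa using this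
  have d1 := funext fun t => (hE t).deriv
  have d2 : deriv (fun t : ℝ ↦ t * Real.exp (t ^ 2 / 2)) = fun t ↦ (1 + t ^ 2) * Real.exp (t ^ 2 / 2) := by
    ext t
    have := ((hasDerivAt_id t).mul (hE' t)).deriv
    convert! this using 1
    simp; ring
  have d3 : deriv (fun t : ℝ ↦ (1 + t ^ 2) * Real.exp (t ^ 2 / 2)) =
      fun t ↦ (3 * t + t ^ 3) * Real.exp (t ^ 2 / 2) := by
    ext t
    have := (((hasDerivAt_pow 2 t).const_add 1).mul (hE' t)).deriv
    convert! this using 1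
    simp; ring
  have d4 : deriv (fun t : ℝ ↦ (3 * t + t ^ 3) * Real.exp (t ^ 2 / 2)) 0 = 3 := by
    have := ((((hasDerivAt_id (0:ℝ)).const_mul 3).add (hasDerivAt_pow 3 (0:ℝ))).mul (hE' 0)).deriv
    convert! this using 1
    simp
  rw [iteratedDeriv_succ, iteratedDeriv_succ, iteratedDeriv_succ, iteratedDeriv_one, d1, d2, d3, d4]

lemma gint (n : ℕ) : Integrable (fun z : ℝ => z ^ n) (gaussianReal 0 1) :=
  integrable_pow_of_mem_interior_integrableExpSet (X := fun x => x) (by simp) n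

lemma g_sq_int : Integrable (fun z : ℝ => (z ^ 2 - 1) ^ 2) (gaussianReal 0 1) := by
  have : (fun z : ℝ => (z ^ 2 - 1) ^ 2) = fun z => z ^ 4 - 2 * z ^ 2 + 1 := by ext; ring
  rw [this]
  exact (((gint 4).sub ((gint 2).const_mul 2)).add (integrable_const 1))

lemma g_sq_val : ∫ z, (z ^ 2 - 1) ^ 2 ∂(gaussianReal 0 1) = 2 := by
  have : (fun z : ℝ => (z ^ 2 - 1) ^ 2) = fun z => z ^ 4 - 2 * z ^ 2 + 1 := by ext; ring
  have h42 : Integrable (fun z : ℝ => z ^ 4 - 2 * z ^ 2) (gaussianReal 0 1) :=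
    (gint 4).sub ((gint 2).const_mul 2)
  rw [this, integral_add h42 (integrable_const 1),
    integral_sub (gint 4) ((gint 2).const_mul 2), integral_const_mul, gm_two, gm_four]
  simp; norm_num

/-- second-order expansion of the characteristic function of `z^2 - 1` -/
lemma cf_exp (t : ℝ) : Tendsto (fun p : ℕ => (p : ℂ) *
    ((∫ z, Complex.exp (((t / √(2 * p) * (z ^ 2 - 1) : ℝ) : ℂ) * Complex.I) ∂(gaussianReal 0 1)) - 1))
    atTop (𝓝 (-(t : ℂ) ^ 2 / 2)) := by
  have hX : AEMeasurable (fun z : ℝ => (z ^ 2 - 1) / √2) (gaussianReal 0 1) := by fun_prop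
  have h0 : (gaussianReal 0 1)[fun z : ℝ => (z ^ 2 - 1) / √2] = 0 := by
    rw [integral_div, integral_sub (gint 2) (integrable_const 1), gm_two]; simp
  have h1 : (gaussianReal 0 1)[(fun z : ℝ => (z ^ 2 - 1) / √2) ^ 2] = 1 := by
    simp only [Pi.pow_apply, div_pow]
    rw [integral_div, g_sq_val]; simp
  have hT := taylor_charFun_two hX h0 h1
  have hs : Tendsto (fun (n : ℕ) ↦ (√n)⁻¹ * t) atTop (𝓝 0) := by
    rw [← zero_mul t]
    exact .mul_const t (tendsto_inv_atTop_zero.comp <| Real.tendsto_sqrt_atTop.comp <|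
      tendsto_natCast_atTop_atTop)
  have h2 := hT.comp_tendsto hs
  have h3 : (fun p : ℕ => (∫ z, Complex.exp (((t / √(2 * p) * (z ^ 2 - 1) : ℝ) : ℂ) * Complex.I)
      ∂(gaussianReal 0 1)) - (1 - (((√p)⁻¹ * t : ℝ) : ℂ) ^ 2 / 2)) =o[atTop]
      (fun n : ℕ => ((√n)⁻¹ * t) ^ 2) := by
    refine h2.congr_left fun p => ?_
    simp only [Function.comp]
    rw [charFun_apply_real, integral_map hX (by fun_prop)]
    congr 2
    ext z
    congr 2
    rw [Real.sqrt_mul (by norm_num)]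
    push_cast
    simp [field]
  have h4 : (fun n : ℕ => ((√n)⁻¹ * t) ^ 2) =O[atTop] (fun n : ℕ => (n : ℝ)⁻¹) := by
    refine Asymptotics.IsBigO.of_bound (t ^ 2) (Eventually.of_forall fun n => ?_)
    rw [mul_pow, inv_pow, Real.sq_sqrt (by positivity)]
    simp [mul_comm]
  have h5 := (h3.trans_isBigO h4).tendsto_inv_smul_nhds_zero
  rw [← tendsto_sub_nhds_zero_iff]
  refine h5.congr' ?_
  filter_upwards [eventually_ne_atTop 0] with n hn
  have : (((√n)⁻¹ * t : ℝ) : ℂ) ^ 2 = (n : ℂ)⁻¹ * t ^ 2 := by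
    rw [← Complex.ofReal_pow, mul_pow, inv_pow, Real.sq_sqrt (by positivity)]
    push_cast; rfl
  rw [this, inv_inv, Complex.real_smul]
  have : (n : ℂ) ≠ 0 := by exact_mod_cast hn
  push_cast
  generalize (∫ z : ℝ, _ ∂_ : ℂ) = J
  field_simp
  ring

lemma trunc_cf (A : ℕ → Set ℝ) (hA : ∀ p, MeasurableSet (A p)) (lam : ℝ)
    (hlim : Tendsto (fun p : ℕ => (p : ℝ) * (gaussianReal 0 1).real (A p)ᶜ) atTop (𝓝 lam)) (t : ℝ) :
    Tendsto (fun p : ℕ => (p : ℂ) *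
    ((∫ z in A p, Complex.exp (((t / √(2 * p) * (z ^ 2 - 1) : ℝ) : ℂ) * Complex.I)
      ∂(gaussianReal 0 1)) - 1))
    atTop (𝓝 (-(t : ℂ) ^ 2 / 2 - lam)) := by
  set γ := gaussianReal 0 1 with hγ
  have hsmall : Tendsto (fun p => γ.real (A p)ᶜ) atTop (𝓝 0) := by
    have := hlim.mul (tendsto_inv_atTop_zero.comp (tendsto_natCast_atTop_atTop (R := ℝ)))
    rw [mul_zero] at this
    refine this.congr' ?_
    filter_upwards [eventually_ne_atTop 0] with n hn
    have : (n : ℝ) ≠ 0 := by exact_mod_cast hn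
    simp only [Function.comp]
    field_simp
  have hI : Tendsto (fun p => ∫ z in (A p)ᶜ, (z ^ 2 - 1) ^ 2 ∂γ) atTop (𝓝 0) := by
    refine g_sq_int.tendsto_setIntegral_nhds_zero ?_
    have h0 : Tendsto (fun p => γ (A p)ᶜ) atTop (𝓝 0) := by
      rw [← ENNReal.tendsto_toReal_iff (fun _ => measure_ne_top _ _) (by simp)]
      exact hsmall
    exact h0
  set I : ℕ → ℝ := fun p => ∫ z in (A p)ᶜ, (z ^ 2 - 1) ^ 2 ∂γ
  have hI0 : ∀ p, 0 ≤ I p := fun p => integral_nonneg fun z => sq_nonneg _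
  have hsI : Tendsto (fun p => √(I p)) atTop (𝓝 0) := by
    have := (Real.continuous_sqrt.tendsto 0).comp hI
    rw [Real.sqrt_zero] at this
    exact this
  let e : ℕ → ℝ → ℂ := fun p z => Complex.exp (((t / √(2 * p) * (z ^ 2 - 1) : ℝ) : ℂ) * Complex.I)
  have he_int : ∀ p, Integrable (e p) γ := by
    intro p
    refine Integrable.of_bound (C := 1) (by fun_prop) (Eventually.of_forall fun z => ?_)
    simp only [e]
    rw [Complex.norm_exp_ofReal_mul_I]
  have key : Tendsto (fun p : ℕ => (p : ℂ) * ∫ z in (A p)ᶜ, (e p z - 1) ∂γ) atTop (𝓝 0) := by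
    have hb : Tendsto (fun p : ℕ => (√(I p) + 1 / ((p : ℝ) + 1)) * ((p : ℝ) * γ.real (A p)ᶜ) +
        t ^ 2 / 2 * √(I p)) atTop (𝓝 0) := by
      have := ((hsI.add tendsto_one_div_add_atTop_nhds_zero_nat).mul hlim).add
        (hsI.const_mul (t ^ 2 / 2))
      simpa using this
    refine squeeze_zero_norm (fun p => ?_) hb
    set ε := √(I p) + 1 / ((p : ℝ) + 1) with hε
    have hεpos : 0 < ε := by positivity
    have hIε : I p / ε ≤ √(I p) := by
      rw [div_le_iff₀ hεpos]
      nth_rewrite 1 [← Real.mul_self_sqrt (hI0 p)]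
      gcongr
      rw [hε]
      have : 0 < 1 / ((p : ℝ) + 1) := by positivity
      linarith
    have hpt : ∀ z, ‖e p z - 1‖ ≤ ε + (t / √(2 * p)) ^ 2 / ε * (z ^ 2 - 1) ^ 2 := by
      intro z
      have h1 : ‖e p z - 1‖ ≤ ‖t / √(2 * p) * (z ^ 2 - 1)‖ := by
        simp only [e]
        rw [mul_comm _ Complex.I]
        exact Real.norm_exp_I_mul_ofReal_sub_one_le
      refine h1.trans ?_
      set u := t / √(2 * p) * (z ^ 2 - 1) with hu
      have : (t / √(2 * p)) ^ 2 / ε * (z ^ 2 - 1) ^ 2 = u ^ 2 / ε := by rw [hu]; ring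
      rw [this, Real.norm_eq_abs, ← sub_nonneg]
      have : ε + u ^ 2 / ε - |u| = ((ε - |u|) ^ 2 + ε * |u|) / ε := by
        rw [← sq_abs u]; field_simp; ring
      rw [this]; positivity
    have h2 : ‖∫ z in (A p)ᶜ, (e p z - 1) ∂γ‖ ≤ ε * γ.real (A p)ᶜ + (t / √(2 * p)) ^ 2 / ε * I p := by
      refine (norm_integral_le_of_norm_le (g := fun z => ε + (t / √(2 * p)) ^ 2 / ε * (z ^ 2 - 1) ^ 2)
        ?_ (Eventually.of_forall hpt)).trans_eq ?_
      · exact (integrable_const _).add (g_sq_int.restrict.const_mul _)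
      · rw [integral_add (integrable_const _) (g_sq_int.restrict.const_mul _), integral_const_mul]
        simp [mul_comm, I, hγ]
    rw [norm_mul, Complex.norm_natCast]
    have h3 : (p : ℝ) * (t / √(2 * p)) ^ 2 ≤ t ^ 2 / 2 := by
      rw [div_pow, Real.sq_sqrt (by positivity)]
      rcases eq_or_ne p 0 with rfl | hp
      · simp; positivity
      · have : (p : ℝ) ≠ 0 := by exact_mod_cast hp
        apply le_of_eq; field_simp
    calc (p : ℝ) * ‖∫ z in (A p)ᶜ, (e p z - 1) ∂γ‖
        ≤ p * (ε * γ.real (A p)ᶜ + (t / √(2 * p)) ^ 2 / ε * I p) := by gcongr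
      _ = ε * (p * γ.real (A p)ᶜ) + (p * (t / √(2 * p)) ^ 2) * (I p / ε) := by ring
      _ ≤ ε * (p * γ.real (A p)ᶜ) + t ^ 2 / 2 * √(I p) := by
          have := div_nonneg (hI0 p) hεpos.le
          gcongr
  have hl' : Tendsto (fun p : ℕ => (((p : ℝ) * γ.real (A p)ᶜ : ℝ) : ℂ)) atTop (𝓝 (lam : ℂ)) :=
    (Complex.continuous_ofReal.tendsto lam).comp hlim
  have := ((cf_exp t).sub hl').sub key
  rw [sub_zero] at this
  refine this.congr fun p => ?_
  have h1 := integral_add_compl (hA p) (he_int p)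
  have h2 : ∫ z in (A p)ᶜ, (e p z - 1) ∂γ = (∫ z in (A p)ᶜ, e p z ∂γ) - (γ.real (A p)ᶜ : ℂ) := by
    rw [integral_sub (he_int p).restrict (integrable_const _)]
    simp
  rw [h2]
  change (p : ℂ) * ((∫ z, e p z ∂γ) - 1) - _ - _ = (p : ℂ) * ((∫ z in A p, e p z ∂γ) - 1)
  rw [← h1]
  push_cast
  ring

lemma abstract_main (A : ℕ → Set ℝ) (hA : ∀ p, MeasurableSet (A p))
    (hA0 : ∀ p, gaussianReal 0 1 (A p) ≠ 0) (lam : ℝ)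
    (hlim : Tendsto (fun p : ℕ => (p : ℝ) * (gaussianReal 0 1).real (A p)ᶜ) atTop (𝓝 lam)) (y : ℝ) :
    Tendsto (fun p : ℕ => ((Measure.pi fun _ : Fin p => gaussianReal 0 1)
      ((Set.univ.pi fun _ => A p) ∩ {z | (∑ i, (z i) ^ 2 - p) / √(2 * p) ≤ y})).toReal) atTop
      (𝓝 (Real.exp (-lam) * (gaussianReal 0 1 (Set.Iic y)).toReal)) := by
  set γ := gaussianReal 0 1 with hγ
  let P : (p : ℕ) → Measure (Fin p → ℝ) := fun p => Measure.pi fun _ : Fin p => γ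
  let B : (p : ℕ) → Set (Fin p → ℝ) := fun p => Set.univ.pi fun _ => A p
  let S : (p : ℕ) → (Fin p → ℝ) → ℝ := fun p z => (∑ i, (z i) ^ 2 - p) / √(2 * p)
  have hSm : ∀ p, Measurable (S p) := fun p => by fun_prop
  have hBm : ∀ p, MeasurableSet (B p) := fun p => MeasurableSet.univ_pi fun _ => hA p
  have hPB : ∀ p, P p (B p) = γ (A p) ^ p := fun p => by
    simp only [P, B]; rw [Measure.pi_pi]; simp
  have hPB0 : ∀ p, P p (B p) ≠ 0 := fun p => by rw [hPB]; exact pow_ne_zero _ (hA0 p)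
  have hprob : ∀ p, IsProbabilityMeasure ((P p)[|B p]) := fun p => cond_isProbabilityMeasure (hPB0 p)
  have hprob' : ∀ p, IsProbabilityMeasure (((P p)[|B p]).map (S p)) := fun p =>
    Measure.isProbabilityMeasure_map (hSm p).aemeasurable
  -- powers of truncated characteristic functions
  have hG : ∀ t : ℝ, Tendsto (fun p : ℕ =>
      (∫ z in A p, Complex.exp (((t / √(2 * p) * (z ^ 2 - 1) : ℝ) : ℂ) * Complex.I) ∂γ) ^ p)
      atTop (𝓝 (Complex.exp (-(t : ℂ) ^ 2 / 2 - lam))) := by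
    intro t
    have := Complex.tendsto_one_add_pow_exp_of_tendsto (trunc_cf A hA lam hlim t)
    refine this.congr fun p => ?_
    rw [add_sub_cancel]
  have hq : Tendsto (fun p : ℕ => ((γ.real (A p) : ℂ)) ^ p) atTop (𝓝 (Complex.exp (-lam))) := by
    have := hG 0
    simpa using this
  have hqr : Tendsto (fun p : ℕ => (P p).real (B p)) atTop (𝓝 (Real.exp (-lam))) := by
    have h1 := (Complex.continuous_re.tendsto _).comp hq
    have h2 : (Complex.exp (-lam)).re = Real.exp (-lam) := by
      rw [← Complex.ofReal_neg, ← Complex.ofReal_exp, Complex.ofReal_re]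
    rw [h2] at h1
    refine h1.congr fun p => ?_
    simp only [Function.comp, Measure.real, hPB, ENNReal.toReal_pow]
    rw [← Complex.ofReal_pow, Complex.ofReal_re]
  have hcf : ∀ (t : ℝ) (p : ℕ), charFun (((P p)[|B p]).map (S p)) t =
      ((γ.real (A p) : ℂ) ^ p)⁻¹ *
      (∫ z in A p, Complex.exp (((t / √(2 * p) * (z ^ 2 - 1) : ℝ) : ℂ) * Complex.I) ∂γ) ^ p := by
    intro t p
    rw [charFun_apply_real, integral_map (hSm p).aemeasurable (by fun_prop), ProbabilityTheory.cond,
      integral_smul_measure]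
    have h1 : (P p).restrict (B p) = Measure.pi fun _ : Fin p => γ.restrict (A p) :=
      Measure.restrict_pi_pi _ _
    rw [h1, hPB]
    have h2 := integral_fintype_prod_eq_pow (ι := Fin p) (μ := γ.restrict (A p))
      (fun z : ℝ => Complex.exp (((t / √(2 * p) * (z ^ 2 - 1) : ℝ) : ℂ) * Complex.I))
    rw [Fintype.card_fin] at h2
    rw [← h2, Complex.real_smul]
    congr 1
    · simp [Measure.real]
    · congr 1
      ext z
      rw [← Complex.exp_sum]
      congr 1
      rw [← Finset.sum_mul]
      congr 1
      rw [← Complex.ofReal_sum, ← Complex.ofReal_mul, ← Finset.mul_sum]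
      congr 1
      simp only [S, Finset.sum_sub_distrib]
      simp
      ring
  let μs : ℕ → ProbabilityMeasure ℝ := fun p => ⟨((P p)[|B p]).map (S p), hprob' p⟩
  let μ0 : ProbabilityMeasure ℝ := ⟨γ, inferInstance⟩
  have hlevy : Tendsto μs atTop (𝓝 μ0) := by
    refine ProbabilityMeasure.tendsto_of_tendsto_charFun fun t => ?_
    have h1 := (hq.inv₀ (Complex.exp_ne_zero _)).mul (hG t)
    have h2 : charFun (μ0 : Measure ℝ) t =
        (Complex.exp (-lam))⁻¹ * Complex.exp (-(t : ℂ) ^ 2 / 2 - lam) := by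
      change charFun γ t = _
      rw [charFun_gaussianReal, ← Complex.exp_neg, ← Complex.exp_add]
      congr 1
      simp
      ring
    rw [h2]
    exact h1.congr fun p => (hcf t p).symm
  have hport := ProbabilityMeasure.tendsto_measure_of_null_frontier_of_tendsto' hlevy
    (E := Set.Iic y) (by
      rw [frontier_Iic]
      change γ {y} = 0
      have := nullSingletonClass_gaussianReal (μ := 0) (v := 1) one_ne_zero
      exact measure_singleton y)
  have hport' := (ENNReal.tendsto_toReal (measure_ne_top _ _)).comp hport
  refine (hqr.mul hport').congr fun p => ?_
  have h1 := cond_mul_eq_inter (hBm p) (S p ⁻¹' Set.Iic y) (P p)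
  change (P p).real (B p) * ((((P p)[|B p]).map (S p)) (Set.Iic y)).toReal =
    (P p (B p ∩ S p ⁻¹' Set.Iic y)).toReal
  rw [← h1, Measure.map_apply (hSm p) measurableSet_Iic, ENNReal.toReal_mul, mul_comm]
  rfl

lemma mills (a : ℝ) (ha : 0 < a) :
    IntegrableOn (fun z : ℝ => (1 + 1 / z ^ 2) * Real.exp (-z ^ 2 / 2)) (Set.Ioi a) ∧
    ∫ z in Set.Ioi a, (1 + 1 / z ^ 2) * Real.exp (-z ^ 2 / 2) = Real.exp (-a ^ 2 / 2) / a := by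
  have hd : ∀ z ∈ Set.Ici a, HasDerivAt (fun z : ℝ => Real.exp (-z ^ 2 / 2) / z)
      (-((1 + 1 / z ^ 2) * Real.exp (-z ^ 2 / 2))) z := by
    intro z hz
    have hz0 : z ≠ 0 := (ha.trans_le hz).ne'
    have h1 : HasDerivAt (fun t : ℝ ↦ -t ^ 2 / 2) (-z) z := by
      have := ((hasDerivAt_pow 2 z).neg).div_const 2
      convert! this using 1; simp; ring
    convert! h1.exp.div (hasDerivAt_id z) hz0 using 1
    simp
    field_simp
    ring
  have hneg : ∀ z ∈ Set.Ioi a, -((1 + 1 / z ^ 2) * Real.exp (-z ^ 2 / 2)) ≤ 0 := by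
    intro z hz
    have : 0 ≤ (1 + 1 / z ^ 2) * Real.exp (-z ^ 2 / 2) := by positivity
    linarith
  have ht : Tendsto (fun z : ℝ => Real.exp (-z ^ 2 / 2) / z) atTop (𝓝 0) := by
    refine squeeze_zero' (g := fun z : ℝ => z⁻¹) ?_ ?_ tendsto_inv_atTop_zero
    · filter_upwards [eventually_gt_atTop 0] with z hz
      positivity
    · filter_upwards [eventually_gt_atTop 0] with z hz
      rw [div_eq_mul_inv]
      refine mul_le_of_le_one_left (by positivity) ?_
      rw [Real.exp_le_one_iff]
      nlinarith [sq_nonneg z]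
  have hi := integrableOn_Ioi_deriv_of_nonpos' hd hneg ht
  refine ⟨by simpa using hi.neg, ?_⟩
  have := integral_Ioi_of_hasDerivAt_of_tendsto' hd hi ht
  rw [integral_neg] at this
  linarith

lemma gauss_compl (a : ℝ) (ha : 0 < a) : (gaussianReal 0 1).real {z : ℝ | z ^ 2 ≤ a ^ 2}ᶜ =
    2 * (√(2 * Real.pi))⁻¹ * ∫ z in Set.Ioi a, Real.exp (-z ^ 2 / 2) := by
  have hset : {z : ℝ | z ^ 2 ≤ a ^ 2}ᶜ = Set.Ioi a ∪ Set.Iio (-a) := by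
    ext z
    simp only [Set.mem_compl_iff, Set.mem_ofPred_eq, Set.mem_union, Set.mem_Ioi, Set.mem_Iio,
      sq_le_sq, abs_of_pos ha, not_le, lt_abs]
    constructor <;> rintro (h | h) <;> [left; right; left; right] <;> linarith
  have hdisj : Disjoint (Set.Ioi a) (Set.Iio (-a)) := by
    rw [Set.disjoint_left]; intro z h1 h2
    simp only [Set.mem_Ioi, Set.mem_Iio] at h1 h2; linarith
  have hsymm : (gaussianReal 0 1) (Set.Iio (-a)) = (gaussianReal 0 1) (Set.Ioi a) := by
    have h := gaussianReal_map_neg (μ := 0) (v := 1)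
    rw [neg_zero] at h
    nth_rewrite 1 [← h]
    rw [Measure.map_apply (by fun_prop) measurableSet_Iio]
    congr 1
    ext z; simp
  rw [hset, measureReal_union hdisj measurableSet_Iio]
  have : (gaussianReal 0 1).real (Set.Ioi a) = (√(2 * Real.pi))⁻¹ * ∫ z in Set.Ioi a, Real.exp (-z ^ 2 / 2) := by
    rw [Measure.real, gaussianReal_apply_eq_integral 0 one_ne_zero, ENNReal.toReal_ofReal, ← integral_const_mul]
    · simp [gaussianPDFReal_def]
    · exact integral_nonneg fun z => gaussianPDFReal_nonneg _ _ _
  have h2 : (gaussianReal 0 1).real (Set.Iio (-a)) = (gaussianReal 0 1).real (Set.Ioi a) := by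
    rw [Measure.real, hsymm]; rfl
  rw [h2, this]; ring

/-- Mills ratio asymptotics. -/
lemma mills_tendsto : Tendsto (fun a : ℝ => (∫ z in Set.Ioi a, Real.exp (-z ^ 2 / 2)) /
    (Real.exp (-a ^ 2 / 2) / a)) atTop (𝓝 1) := by
  have hlow : Tendsto (fun a : ℝ => (1 + 1 / a ^ 2)⁻¹) atTop (𝓝 1) := by
    have : Tendsto (fun a : ℝ => 1 / a ^ 2) atTop (𝓝 0) := by
      simp_rw [one_div]
      exact tendsto_inv_atTop_zero.comp (tendsto_pow_atTop two_ne_zero)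
    have := (this.const_add 1).inv₀ (by norm_num)
    simpa using this
  have hint : Integrable (fun z : ℝ => Real.exp (-z ^ 2 / 2)) := by
    have := integrable_exp_neg_mul_sq (b := 1 / 2) (by norm_num)
    refine this.congr (Eventually.of_forall fun z => ?_)
    simp only; congr 1; ring
  refine tendsto_of_tendsto_of_tendsto_of_le_of_le' hlow tendsto_const_nhds ?_ ?_
  · filter_upwards [eventually_gt_atTop 0] with a ha
    obtain ⟨hi, hv⟩ := mills a ha
    rw [← hv]
    have hpos : 0 < ∫ z in Set.Ioi a, (1 + 1 / z ^ 2) * Real.exp (-z ^ 2 / 2) := by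
      rw [hv]; positivity
    rw [le_div_iff₀ hpos, inv_mul_le_iff₀ (by positivity), ← integral_const_mul]
    refine setIntegral_mono_on hi (hint.integrableOn.const_mul _) measurableSet_Ioi fun z hz => ?_
    have : a ≤ z := le_of_lt hz
    gcongr
  · filter_upwards [eventually_gt_atTop 0] with a ha
    obtain ⟨hi, hv⟩ := mills a ha
    rw [← hv]
    have hpos : 0 < ∫ z in Set.Ioi a, (1 + 1 / z ^ 2) * Real.exp (-z ^ 2 / 2) := by
      rw [hv]; positivity
    rw [div_le_one hpos]
    refine setIntegral_mono_on hint.integrableOn hi measurableSet_Ioi fun z hz => ?_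
    refine le_mul_of_one_le_left (by positivity) ?_
    have : 0 ≤ 1 / z ^ 2 := by positivity
    linarith

lemma cut_ratio (x : ℝ) : Tendsto (fun p : ℕ =>
    (x + 2 * Real.log p - Real.log (Real.log p)) / Real.log p) atTop (𝓝 2) := by
  have hL : Tendsto (fun p : ℕ => Real.log p) atTop atTop :=
    Real.tendsto_log_atTop.comp tendsto_natCast_atTop_atTop
  have h1 : Tendsto (fun p : ℕ => x / Real.log p) atTop (𝓝 0) := hL.const_div_atTop x
  have h2 : Tendsto (fun p : ℕ => Real.log (Real.log p) / Real.log p) atTop (𝓝 0) :=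
    (Real.isLittleO_log_id_atTop.tendsto_div_nhds_zero).comp hL
  have h3 := (h1.add_const 2).sub h2
  rw [zero_add, sub_zero] at h3
  refine h3.congr' ?_
  filter_upwards [hL.eventually_gt_atTop 0] with p hp
  field_simp

lemma cut_atTop (x : ℝ) : Tendsto (fun p : ℕ =>
    x + 2 * Real.log p - Real.log (Real.log p)) atTop atTop := by
  have hL : Tendsto (fun p : ℕ => Real.log p) atTop atTop :=
    Real.tendsto_log_atTop.comp tendsto_natCast_atTop_atTop
  refine ((cut_ratio x).pos_mul_atTop (by norm_num) hL).congr' ?_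
  filter_upwards [hL.eventually_gt_atTop 0] with p hp
  field_simp

lemma tail_lim (x : ℝ) : Tendsto (fun p : ℕ => (p : ℝ) * (gaussianReal 0 1).real
    {z : ℝ | z ^ 2 ≤ max (x + 2 * Real.log p - Real.log (Real.log p)) 1}ᶜ) atTop
    (𝓝 (1 / √Real.pi * Real.exp (-x / 2))) := by
  have hL : Tendsto (fun p : ℕ => Real.log p) atTop atTop :=
    Real.tendsto_log_atTop.comp tendsto_natCast_atTop_atTop
  have hc := cut_atTop x
  have h1 := mills_tendsto.comp (Real.tendsto_sqrt_atTop.comp hc)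
  have h2 : Tendsto (fun p : ℕ => √((x + 2 * Real.log p - Real.log (Real.log p)) / Real.log p))
      atTop (𝓝 √2) := (Real.continuous_sqrt.tendsto 2).comp (cut_ratio x)
  have h3 := (h1.div h2 (by positivity)).const_mul (2 * (√(2 * Real.pi))⁻¹ * Real.exp (-x / 2))
  have hv : 2 * (√(2 * Real.pi))⁻¹ * Real.exp (-x / 2) * (1 / √2) =
      1 / √Real.pi * Real.exp (-x / 2) := by
    rw [Real.sqrt_mul (by norm_num)]
    have : √2 * √2 = (2 : ℝ) := Real.mul_self_sqrt (by norm_num)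
    have h0 : √Real.pi ≠ 0 := by positivity
    field_simp
    nlinarith
  rw [hv] at h3
  refine h3.congr' ?_
  filter_upwards [hL.eventually_gt_atTop 0, hc.eventually_ge_atTop 1, eventually_gt_atTop 0]
    with p hp hc1 hp0
  have hpr : (0 : ℝ) < p := by exact_mod_cast hp0
  set c := x + 2 * Real.log p - Real.log (Real.log p) with hcdef
  have hcpos : 0 < c := by linarith
  rw [max_eq_left hc1]
  have hs : 0 < √c := Real.sqrt_pos.2 hcpos
  have hg := gauss_compl (√c) hs
  rw [Real.sq_sqrt hcpos.le] at hg
  rw [hg]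
  simp only [Function.comp, Pi.div_apply, ← hcdef]
  rw [Real.sq_sqrt hcpos.le, Real.sqrt_div hcpos.le]
  have hexp : Real.exp (-c / 2) = Real.exp (-x / 2) * √(Real.log p) / p := by
    have e1 : -c / 2 = -x / 2 + Real.log (Real.log p) / 2 - Real.log p := by rw [hcdef]; ring
    rw [e1, Real.exp_sub, Real.exp_add, Real.exp_log hpr, ← Real.log_sqrt hp.le,
      Real.exp_log (Real.sqrt_pos.2 hp)]
  rw [hexp]
  have hl : 0 < √(Real.log p) := Real.sqrt_pos.2 hp
  generalize (∫ z in Set.Ioi √c, Real.exp (-z ^ 2 / 2)) = J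
  field_simp

/-- **Asymptotic independence of the max-type and sum-type statistics of a standard Gaussian
vector** (the Gaussian core of Theorem 5). For each `p`, let `Z = (Z₁, …, Z_p)` be a standard
Gaussian random vector in `ℝᵖ` (its law being the `p`-fold product of `N(0,1)`), and set
`M_p = max_i Zᵢ² - 2 log p + log log p` and `S_p = (‖Z‖² - p)/√(2p)`. Then for all `x, y ∈ ℝ`,
`P(M_p ≤ x, S_p ≤ y) → F(x) Φ(y)` as `p → ∞`, where `F(x) = exp(-π^{-1/2} e^{-x/2})` and `Φ`
is the standard normal distribution function. -/
theorem asymptotic_independence_max_sum_gaussian (x y : ℝ) :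
    Tendsto
      (fun p : ℕ =>
        ((Measure.pi fun _ : Fin p => gaussianReal 0 1)
          {z | (⨆ i : Fin p, (z i) ^ 2) - 2 * Real.log p + Real.log (Real.log p) ≤ x ∧
               (∑ i, (z i) ^ 2 - p) / Real.sqrt (2 * p) ≤ y}).toReal)
      atTop
      (nhds (Real.exp (-(1 / Real.sqrt Real.pi) * Real.exp (-x / 2)) *
        (gaussianReal 0 1 (Set.Iic y)).toReal)) := by
  have h := abstract_main
    (fun p : ℕ => {z : ℝ | z ^ 2 ≤ max (x + 2 * Real.log p - Real.log (Real.log p)) 1})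
    (fun p => measurableSet_le (by fun_prop) (by fun_prop)) (fun p => ?_)
    (1 / √Real.pi * Real.exp (-x / 2)) (tail_lim x) y
  · rw [neg_mul]
    refine h.congr' ?_
    filter_upwards [(cut_atTop x).eventually_ge_atTop 1, eventually_gt_atTop 0] with p hc hp
    congr 2
    ext z
    have : Nonempty (Fin p) := ⟨⟨0, hp⟩⟩
    simp only [max_eq_left hc, Set.mem_inter_iff, Set.mem_pi, Set.mem_univ, true_imp_iff,
      Set.mem_ofPred_eq]
    refine and_congr_left fun _ => ?_
    rw [← ciSup_le_iff (Set.finite_range _).bddAbove]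
    constructor <;> intro h <;> linarith
  · intro h0
    have hac := gaussianReal_absolutelyContinuous' 0 (v := 1) one_ne_zero
    have h1 := hac h0
    have h2 : Set.Icc (0 : ℝ) 1 ⊆
        {z : ℝ | z ^ 2 ≤ max (x + 2 * Real.log p - Real.log (Real.log p)) 1} := by
      intro z hz
      exact (pow_le_one₀ hz.1 hz.2).trans (le_max_right _ _)
    have h3 := measure_mono_null h2 h1
    simp at h3
end
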